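/- arXiv:1311.0858 — 6 statements merged into one kernel-verified Lean document; each statement's English description precedes it below -/
import Mathlib

section
/- If f is a weak IASI of a finite simple graph G, then every edge of G has at least one mono-indexed end vertex; that is, for every edge uv of G, |f(u)| = 1 or |f(v)| = 1. -/
open Pointwise

/-- The induced set-label on edges: the sumset of the set-labels of the two end vertices. -/
def edgeLabel {V : Type*} (f : V → Finset ℕ) : Sym2 V → Finset ℕ :=
  Sym2.lift ⟨fun u v => f u + f v, fun u v => add_comm (f u) (f v)⟩

/-- `f` is a weak integer additive set-indexer (weak IASI) of the simple graph `G`: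
`f` assigns nonempty finite sets of naturals to vertices injectively, the induced
sumset-labeling of the edges is injective on the edge set, and for every edge `uv`,
`|f(u) + f(v)| = max (|f(u)|, |f(v)|)`. -/
def IsWeakIASI {V : Type*} (G : SimpleGraph V) (f : V → Finset ℕ) : Prop :=
  (∀ v, (f v).Nonempty) ∧ Function.Injective f ∧
  Set.InjOn (edgeLabel f) G.edgeSet ∧
  ∀ ⦃u v⦄, G.Adj u v → (f u + f v).card = max (f u).card (f v).card

/-- If f is a weak IASI of a finite simple graph G, then every edge of G has at
least one mono-indexed end vertex. -/
theorem weakIASI_edge_mono_endvertex {V : Type*} [Fintype V] (G : SimpleGraph V)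
    (f : V → Finset ℕ) (hf : IsWeakIASI G f) :
    ∀ ⦃u v : V⦄, G.Adj u v → (f u).card = 1 ∨ (f v).card = 1 := by
  intro u v huv
  obtain ⟨hne, -, -, hw⟩ := hf
  have h1 := hw huv
  have h2 := cauchy_davenport_add_of_linearOrder_isCancelAdd (hne u) (hne v)
  have h3 := (hne u).card_pos
  have h4 := (hne v).card_pos
  have h5 : (f u).card + (f v).card - 1 ≤ max (f u).card (f v).card := by
    rw [← h1]
    convert h2
  omega
end

section
/- A finite simple graph G admits a weak IASI in which no edge is mono-indexed if and only if G is bipartite. -/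
open Pointwise

theorem pair_aux {a k a' k' : ℕ}
    (h : ({a, a + (k + 1)} : Finset ℕ) = {a', a' + (k' + 1)}) : a = a' ∧ k = k' := by
  have h1 : a ∈ ({a', a' + (k' + 1)} : Finset ℕ) := by rw [← h]; simp
  have h2 : a + (k + 1) ∈ ({a', a' + (k' + 1)} : Finset ℕ) := by rw [← h]; simp
  have h3 : a' ∈ ({a, a + (k + 1)} : Finset ℕ) := by rw [h]; simp
  have h4 : a' + (k' + 1) ∈ ({a, a + (k + 1)} : Finset ℕ) := by rw [h]; simp
  simp only [Finset.mem_insert, Finset.mem_singleton] at h1 h2 h3 h4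
  omega

/-- A finite simple graph admits a weak IASI with no mono-indexed edge if and only
if it is bipartite (i.e. 2-colorable). -/
theorem weakIASI_no_mono_edge_iff_bipartite {V : Type*} [Fintype V] (G : SimpleGraph V) :
    (∃ f, IsWeakIASI G f ∧ ∀ ⦃u v : V⦄, G.Adj u v → (f u + f v).card ≠ 1) ↔
      G.Colorable 2 := by
  constructor
  · rintro ⟨f, ⟨hne, -, -, hmax⟩, hmono⟩
    refine ⟨SimpleGraph.Coloring.mk (fun v => if (f v).card = 1 then (0 : Fin 2) else 1) ?_⟩
    intro u v huv heq
    have h1 := hmax huv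
    have h2 := hmono huv
    have h3 := cauchy_davenport_add_of_linearOrder_isCancelAdd (hne u) (hne v)
    have h4 := (hne u).card_pos
    have h5 := (hne v).card_pos
    by_cases hu : (f u).card = 1 <;> by_cases hv : (f v).card = 1
    · rw [hu, hv] at h1
      simp at h1
      simp [h1] at h2
    · simp [hu, hv] at heq
    · simp [hu, hv] at heq
    · omega
  · rintro ⟨c⟩
    let e : V → ℕ := fun v => (Fintype.equivFin V v : ℕ)
    have he : Function.Injective e := fun a b h =>
      (Fintype.equivFin V).injective (Fin.ext h)
    let f : V → Finset ℕ := fun v => if c v = 0 then {e v} else {0, 0 + (e v + 1)}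
    have f0 : ∀ v, c v = 0 → f v = {e v} := fun v h => if_pos h
    have f1 : ∀ v, c v ≠ 0 → f v = {0, 0 + (e v + 1)} := fun v h => if_neg h
    have hs : ∀ u v, c u = 0 → c v ≠ 0 → f u + f v = {e u, e u + (e v + 1)} := by
      intro u v hu hv
      rw [f0 u hu, f1 v hv]
      ext x
      simp [Finset.mem_add, eq_comm]
    have c0 : ∀ v, c v = 0 → (f v).card = 1 := fun v h => by rw [f0 v h]; simp
    have c1 : ∀ v, c v ≠ 0 → (f v).card = 2 := fun v h => by
      rw [f1 v h]; exact Finset.card_pair (by omega)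
    have cs : ∀ u v, c u = 0 → c v ≠ 0 → (f u + f v).card = 2 := fun u v hu hv => by
      rw [hs u v hu hv]; exact Finset.card_pair (by omega)
    have hcase : ∀ u v, G.Adj u v → (c u = 0 ∧ c v ≠ 0) ∨ (c v = 0 ∧ c u ≠ 0) := by
      intro u v h
      have := c.valid h
      generalize c u = a at *
      generalize c v = b at *
      omega
    have hc2 : ∀ u v, G.Adj u v →
        (f u + f v).card = 2 ∧ max (f u).card (f v).card = 2 := by
      intro u v h
      rcases hcase u v h with ⟨h0, h1⟩ | ⟨h0, h1⟩
      · exact ⟨cs u v h0 h1, by rw [c0 u h0, c1 v h1]; rfl⟩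
      · exact ⟨by rw [add_comm]; exact cs v u h0 h1, by rw [c0 v h0, c1 u h1]; rfl⟩
    have hor : ∀ z ∈ G.edgeSet, ∃ u v, z = s(u, v) ∧ c u = 0 ∧ c v ≠ 0 := by
      intro z
      induction z using Sym2.ind with
      | _ u v =>
        intro h
        rcases hcase u v h with h' | h'
        · exact ⟨u, v, rfl, h'⟩
        · exact ⟨v, u, Sym2.eq_swap, h'⟩
    refine ⟨f, ⟨?_, ?_, ?_, ?_⟩, ?_⟩
    · intro v
      by_cases h : c v = 0
      · rw [f0 v h]; simp
      · rw [f1 v h]; simp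
    · intro u v h
      by_cases hu : c u = 0 <;> by_cases hv : c v = 0
      · rw [f0 u hu, f0 v hv] at h
        exact he (Finset.singleton_injective h)
      · have := c0 u hu
        rw [h, c1 v hv] at this
        omega
      · have := c1 u hu
        rw [h, c0 v hv] at this
        omega
      · rw [f1 u hu, f1 v hv] at h
        exact he (pair_aux h).2
    · intro z hz w hw h
      obtain ⟨u, v, rfl, hu, hv⟩ := hor z hz
      obtain ⟨u', v', rfl, hu', hv'⟩ := hor w hw
      change f u + f v = f u' + f v' at h
      rw [hs u v hu hv, hs u' v' hu' hv'] at h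
      obtain ⟨h1, h2⟩ := pair_aux h
      rw [he h1, he h2]
    · intro u v h
      rw [(hc2 u v h).1, (hc2 u v h).2]
    · intro u v h
      rw [(hc2 u v h).1]
      omega
end

section
/- Let n ≥ 3 be an odd integer. Then every weak IASI of the cycle graph C_n has at least one mono-indexed edge. -/
open Pointwise

/-- Every weak IASI of an odd cycle (n odd, n >= 3) has at least one
mono-indexed edge. -/
theorem weakIASI_odd_cycle_mono_edge (n : ℕ) (hn : 3 ≤ n) (hodd : Odd n)
    (f : Fin n → Finset ℕ) (hf : IsWeakIASI (SimpleGraph.cycleGraph n) f) :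
    ∃ u v : Fin n, (SimpleGraph.cycleGraph n).Adj u v ∧ (f u + f v).card = 1 := by
  obtain ⟨hne, -, -, hcard⟩ := hf
  by_contra hcon
  push Not at hcon
  have C : (SimpleGraph.cycleGraph n).Coloring Bool :=
    SimpleGraph.Coloring.mk (fun v => decide ((f v).card = 1)) (by
      intro u v huv h
      have h1 := hcard huv
      have h2 := hcon u v huv
      have hu := (hne u).card_pos
      have hv := (hne v).card_pos
      have h3 := cauchy_davenport_add_of_linearOrder_isCancelAdd (hne u) (hne v)
      have h4 : (f u).card = 1 ↔ (f v).card = 1 := by simpa using h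
      omega)
  have h2 : (SimpleGraph.cycleGraph n).Colorable 2 := C.colorable
  have h3 := h2.chromaticNumber_le
  rw [SimpleGraph.chromaticNumber_cycleGraph_of_odd n (by omega) hodd] at h3
  exact absurd h3 (by decide)
end

section
/- Let n ≥ 3 and let f be a weak IASI of the cycle graph C_n. Then the number of mono-indexed edges of C_n under f is congruent to n modulo 2; that is, the number of mono-indexed edges is odd when n is odd and even when n is even. -/
open Pointwise

/-- For a weak IASI of the cycle graph on n vertices (n >= 3), the number of
mono-indexed edges is congruent to n modulo 2. -/
theorem weakIASI_cycle_mono_edges_parity (n : ℕ) (hn : 3 ≤ n)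
    (f : Fin n → Finset ℕ) (hf : IsWeakIASI (SimpleGraph.cycleGraph n) f) :
    {e ∈ (SimpleGraph.cycleGraph n).edgeSet | (edgeLabel f e).card = 1}.ncard % 2
      = n % 2 := by
  classical
  obtain ⟨m, rfl⟩ : ∃ m, n = m + 2 := ⟨n - 2, by omega⟩
  obtain ⟨hne, -, -, hw⟩ := hf
  have hadj : ∀ i : Fin (m + 2), (SimpleGraph.cycleGraph (m + 2)).Adj i (i + 1) := by
    intro i
    rw [SimpleGraph.cycleGraph_adj]
    right
    simp
  have hpos : ∀ i, 1 ≤ (f i).card := fun i => (hne i).card_pos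
  have hmin : ∀ i : Fin (m + 2), (f i).card = 1 ∨ (f (i + 1)).card = 1 := by
    intro i
    have h1 := hw (hadj i)
    have h2 := cauchy_davenport_add_of_linearOrder_isCancelAdd (hne i) (hne (i + 1))
    have := hpos i
    have := hpos (i + 1)
    omega
  have hmono : ∀ i : Fin (m + 2), (f i + f (i + 1)).card = 1 ↔
      ((f i).card = 1 ∧ (f (i + 1)).card = 1) := by
    intro i
    have h1 := hw (hadj i)
    have := hpos i
    have := hpos (i + 1)
    omega
  have h11 : (1 : Fin (m + 2)) + 1 ≠ 0 := by
    intro h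
    have := congrArg Fin.val h
    rw [Fin.val_add] at this
    simp only [Fin.val_one, Fin.val_zero] at this
    rw [Nat.mod_eq_of_lt (by omega)] at this
    omega
  have hinj : Function.Injective (fun i : Fin (m + 2) => s(i, i + 1)) := by
    intro i j hij
    simp only [Sym2.eq_iff] at hij
    rcases hij with ⟨h, -⟩ | ⟨h, h'⟩
    · exact h
    · exfalso
      apply h11
      rw [h, add_assoc] at h'
      simpa using h'
  set M : Finset (Fin (m + 2)) :=
    Finset.univ.filter (fun i => (f i).card = 1 ∧ (f (i + 1)).card = 1) with hM
  have hset : {e ∈ (SimpleGraph.cycleGraph (m + 2)).edgeSet | (edgeLabel f e).card = 1}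
      = ((M.image (fun i : Fin (m + 2) => s(i, i + 1)) : Finset _) : Set (Sym2 (Fin (m + 2)))) := by
    ext e
    simp only [Set.mem_setOf_eq, Finset.coe_image, Set.mem_image, Finset.mem_coe, hM,
      Finset.mem_filter, Finset.mem_univ, true_and]
    constructor
    · induction e with
      | _ u v =>
        rintro ⟨he, hc⟩
        rw [SimpleGraph.mem_edgeSet, SimpleGraph.cycleGraph_adj] at he
        change (f u + f v).card = 1 at hc
        rcases he with he | he
        · have hu : u = v + 1 := by rw [← he]; abel
          subst hu
          rw [add_comm] at hc
          exact ⟨v, (hmono v).1 hc, Sym2.eq_swap⟩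
        · have hu : v = u + 1 := by rw [← he]; abel
          subst hu
          exact ⟨u, (hmono u).1 hc, rfl⟩
    · rintro ⟨i, hi, rfl⟩
      exact ⟨hadj i, (hmono i).2 hi⟩
  rw [hset, Set.ncard_coe_finset, Finset.card_image_of_injective _ hinj]
  set T : Finset (Fin (m + 2)) := Finset.univ.filter (fun i => (f i).card ≠ 1) with hT
  set T' : Finset (Fin (m + 2)) := Finset.univ.filter (fun i => (f (i + 1)).card ≠ 1) with hT'
  have hTT : T'.card = T.card := by
    apply Finset.card_bij (fun i _ => i + 1)
    · intro i hi
      simpa [hT, hT'] using hi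
    · intro i _ j _ h
      exact add_right_cancel h
    · intro j hj
      refine ⟨j - 1, ?_, by simp⟩
      simpa [hT, hT'] using hj
  have hdis : Disjoint T T' := by
    rw [Finset.disjoint_left]
    intro i hi hi'
    simp only [hT, hT', Finset.mem_filter, Finset.mem_univ, true_and] at hi hi'
    rcases hmin i with h | h
    · exact hi h
    · exact hi' h
  have hcompl : M = (T ∪ T')ᶜ := by
    ext i
    simp [hM, hT, hT']
  have hc := Finset.card_compl_add_card (T ∪ T')
  rw [← hcompl, Finset.card_union_of_disjoint hdis, hTT, Fintype.card_fin] at hc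
  omega
end

section
/- For every n ≥ 1, every weak IASI of the complete graph K_n has at least (n−1)(n−2)/2 mono-indexed edges. -/
open Pointwise

/-- Every weak IASI of the complete graph on n vertices (n >= 1) has at least
(n-1)(n-2)/2 mono-indexed edges. -/
theorem weakIASI_complete_mono_edges_lower_bound (n : ℕ) (hn : 1 ≤ n)
    (f : Fin n → Finset ℕ) (hf : IsWeakIASI (⊤ : SimpleGraph (Fin n)) f) :
    (n - 1) * (n - 2) / 2 ≤
      {e ∈ (⊤ : SimpleGraph (Fin n)).edgeSet | (edgeLabel f e).card = 1}.ncard := by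
  obtain ⟨hne, -, -, hw⟩ := hf
  have key : ∀ u v, u ≠ v → (f u).card = 1 ∨ (f v).card = 1 := by
    intro u v huv
    have h1 := hw (u := u) (v := v) (by simpa using huv)
    have h2 := cauchy_davenport_add_of_linearOrder_isCancelAdd (hne u) (hne v)
    have h3 := (hne u).card_pos
    have h4 := (hne v).card_pos
    omega
  have hv : ∃ v0, ∀ w, w ≠ v0 → (f w).card = 1 := by
    by_cases h : ∃ v0, (f v0).card ≠ 1
    · obtain ⟨v0, h0⟩ := h
      exact ⟨v0, fun w hwv => (key w v0 hwv).resolve_right h0⟩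
    · push Not at h
      exact ⟨⟨0, hn⟩, fun w _ => h w⟩
  obtain ⟨v0, h0⟩ := hv
  have hc := Sym2.card_image_offDiag (Finset.univ.erase v0)
  rw [Finset.card_erase_of_mem (Finset.mem_univ _), Finset.card_univ, Fintype.card_fin,
    Nat.choose_two_right, Nat.sub_sub] at hc
  rw [← hc, ← Set.ncard_coe_finset]
  apply Set.ncard_le_ncard _ (Set.toFinite _)
  intro e he
  simp only [Finset.coe_image, Set.mem_image, Finset.mem_coe, Finset.mem_offDiag,
    Finset.mem_erase, Finset.mem_univ, and_true] at he
  obtain ⟨⟨a, b⟩, ⟨ha, hb, hab⟩, rfl⟩ := he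
  have hadj : (⊤ : SimpleGraph (Fin n)).Adj a b := by simpa using hab
  refine ⟨hadj, ?_⟩
  change (f a + f b).card = 1
  rw [hw hadj, h0 a ha, h0 b hb, max_self]
end

section
/- Let G₁ and G₂ be finite simple graphs with G₂ having at least one vertex. If the Cartesian product G₁ □ G₂ admits a weak IASI, then G₁ admits a weak IASI. -/
open Pointwise

/-- If the Cartesian product admits a weak IASI (the second factor having at least
one vertex), then the first factor admits a weak IASI. -/
theorem weakIASI_boxProd_factor {α β : Type*} [Fintype α] [Fintype β] [Nonempty β]
    (G₁ : SimpleGraph α) (G₂ : SimpleGraph β)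
    (h : ∃ f, IsWeakIASI (G₁ □ G₂) f) :
    ∃ f, IsWeakIASI G₁ f := by
  obtain ⟨f, hne, hinj, hedge, hcard⟩ := h
  obtain ⟨b⟩ := ‹Nonempty β›
  refine ⟨fun a => f (a, b), fun a => hne _, ?_, ?_, ?_⟩
  · intro x y hxy
    exact congrArg Prod.fst (hinj hxy)
  · intro e he e' he' hee
    induction e using Sym2.ind with | _ x y
    induction e' using Sym2.ind with | _ z w
    have h1 : s((x, b), (y, b)) ∈ (G₁ □ G₂).edgeSet := by
      simpa [SimpleGraph.boxProd_adj] using he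
    have h2 : s((z, b), (w, b)) ∈ (G₁ □ G₂).edgeSet := by
      simpa [SimpleGraph.boxProd_adj] using he'
    have h3 : s((x, b), (y, b)) = s((z, b), (w, b)) := hedge h1 h2 hee
    exact congrArg (Sym2.map Prod.fst) h3
  · intro u v huv
    exact hcard (by simpa [SimpleGraph.boxProd_adj] using huv)
end
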